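/- Let F be a finite weakly posi-uncrossable biset family on a finite set V. Let p = max_{Ŝ∈F} |S| and γ = max_{Ŝ∈F} |Γ(Ŝ)| (both 0 if F is empty), and let ν_F be the maximum number of pairwise strongly disjoint bisets in F. Then |⋃_{Ŝ∈F} S| ≤ p(2γ + 1)·ν_F. -/

import Mathlib

noncomputable section

attribute [local instance] Classical.propDecidable

/-- A biset on `V`: an ordered pair of finsets `inner ⊆ outer`. -/
structure Biset (V : Type*) where
  inner : Finset V
  outer : Finset V
  subset : inner ⊆ outer

namespace Biset

variable {V : Type*} [DecidableEq V]

instance [Fintype V] : Fintype (Biset V) :=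
  Fintype.ofInjective (fun A => (A.inner, A.outer))
    (fun A B h => by
      cases A; cases B
      simp only [Prod.mk.injEq] at h
      cases h.1; cases h.2; rfl)

/-- The boundary `Γ(Ŝ) = S⁺ ∖ S`. -/
def boundary (A : Biset V) : Finset V := A.outer \ A.inner

def inter (A B : Biset V) : Biset V :=
  ⟨A.inner ∩ B.inner, A.outer ∩ B.outer, Finset.inter_subset_inter A.subset B.subset⟩

def union (A B : Biset V) : Biset V :=
  ⟨A.inner ∪ B.inner, A.outer ∪ B.outer, Finset.union_subset_union A.subset B.subset⟩

def diff (A B : Biset V) : Biset V :=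
  ⟨A.inner \ B.outer, A.outer \ B.inner, Finset.sdiff_subset_sdiff A.subset B.subset⟩

/-- Biset containment: `X̂ ⊆ Ŷ` iff `X ⊆ Y` and `X⁺ ⊆ Y⁺`. -/
def Sub (A B : Biset V) : Prop := A.inner ⊆ B.inner ∧ A.outer ⊆ B.outer

def Laminar (L : Finset (Biset V)) : Prop :=
  ∀ A ∈ L, ∀ B ∈ L, Sub A B ∨ Sub B A ∨ A.inner ∩ B.inner = ∅

def StronglyLaminar (L : Finset (Biset V)) : Prop :=
  ∀ A ∈ L, ∀ B ∈ L, Sub A B ∨ Sub B A ∨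
    (A.inner ∩ B.outer = ∅ ∧ B.inner ∩ A.outer = ∅)

def IntersectingSupermodular (f : Biset V → ℤ) : Prop :=
  ∀ A B : Biset V, (A.inner ∩ B.inner).Nonempty →
    f A + f B ≤ f (inter A B) + f (union A B)

def SkewSupermodular (f : Biset V → ℤ) : Prop :=
  ∀ A B : Biset V,
    f A + f B ≤ f (inter A B) + f (union A B) ∨
    f A + f B ≤ f (diff A B) + f (diff B A)

def vertexBiset (v : V) : Biset V := ⟨{v}, {v}, Finset.Subset.refl _⟩

end Biset

/-- `γ = max { |Γ(Ŝ)| : f(Ŝ) > 0 }` (0 if no such biset exists). -/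
def gammaOf {V : Type*} [Fintype V] [DecidableEq V] (f : Biset V → ℤ) : ℕ :=
  (Finset.univ.filter fun A : Biset V => 0 < f A).sup fun A => (Biset.boundary A).card

/-- The leaves (inclusion-minimal members) of a biset family. -/
def leaves {V : Type*} (L : Finset (Biset V)) : Finset (Biset V) :=
  L.filter fun A => ∀ B ∈ L, Biset.Sub B A → B = A

/-- `max_{Ŝ ∈ L} |Γ(Ŝ)|` (0 if `L` is empty). -/
def gammaL {V : Type*} [DecidableEq V] (L : Finset (Biset V)) : ℕ :=
  L.sup fun A => (Biset.boundary A).card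

/-- Two bisets are strongly disjoint if `X∩Y⁺ = ∅` and `Y∩X⁺ = ∅`. -/
def StronglyDisjoint {V : Type*} [DecidableEq V] (A B : Biset V) : Prop :=
  A.inner ∩ B.outer = ∅ ∧ B.inner ∩ A.outer = ∅

/-- A biset family is weakly posi-uncrossable. -/
def WeaklyPosiUncrossable {V : Type*} [DecidableEq V] (F : Finset (Biset V)) : Prop :=
  ∀ A ∈ F, ∀ B ∈ F, (A.inner \ B.outer).Nonempty → (B.inner \ A.outer).Nonempty →
    Biset.diff A B ∈ F ∨ Biset.diff B A ∈ F

/-- `ν_F`: the maximum number of pairwise strongly disjoint bisets in `F`. -/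
def nuOf {V : Type*} [DecidableEq V] (F : Finset (Biset V)) : ℕ :=
  (F.powerset.filter fun D =>
    ∀ A ∈ D, ∀ B ∈ D, A ≠ B → StronglyDisjoint A B).sup Finset.card

/-- A finite digraph whose in-degrees are at most `g` has an independent set containing at least
a `1 / (2 g + 1)` fraction of its vertices. -/
theorem exists_independent_of_inDegree_le {ι : Type*} (r : ι → ι → Prop) (g : ℕ)
    (T : Finset ι) (hT : ∀ j ∈ T, (T.filter fun i => r i j).card ≤ g) :
    ∃ I ⊆ T, (∀ i ∈ I, ∀ j ∈ I, i ≠ j → ¬ r i j) ∧ T.card ≤ (2 * g + 1) * I.card := by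
  induction T using Finset.strongInduction with
  | H T ih =>
    rcases T.eq_empty_or_nonempty with rfl | hne
    · exact ⟨∅, by simp, by simp, by simp⟩
    obtain ⟨t, ht, hout⟩ : ∃ t ∈ T, (T.filter fun j => r t j).card ≤ g := by
      refine Finset.exists_le_of_sum_le hne ?_
      calc ∑ i ∈ T, (T.filter fun j => r i j).card
          = ∑ j ∈ T, (T.filter fun i => r i j).card :=
            Finset.sum_card_bipartiteAbove_eq_sum_card_bipartiteBelow r
        _ ≤ ∑ _j ∈ T, g := Finset.sum_le_sum hT
    set N := insert t ((T.filter fun i => r i t) ∪ T.filter fun j => r t j) with hN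
    have hNcard : N.card ≤ 2 * g + 1 := by
      have h₁ := Finset.card_insert_le t ((T.filter fun i => r i t) ∪ T.filter fun j => r t j)
      have h₂ := Finset.card_union_le (T.filter fun i => r i t) (T.filter fun j => r t j)
      have h₃ := hT t ht
      rw [← hN] at h₁
      omega
    have htN : t ∈ N := Finset.mem_insert_self _ _
    have hss : T \ N ⊂ T :=
      Finset.ssubset_iff_of_subset Finset.sdiff_subset |>.2 ⟨t, ht, by simp [htN]⟩
    obtain ⟨I, hI, hind, hcard⟩ := ih (T \ N) hss fun j hj =>
      (Finset.card_le_card (Finset.filter_subset_filter _ Finset.sdiff_subset)).trans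
        (hT j (Finset.mem_sdiff.1 hj).1)
    have hIN : ∀ i ∈ I, ¬ r i t ∧ ¬ r t i := fun i hi => by
      have := hI hi
      simp only [hN, Finset.mem_sdiff, Finset.mem_insert, Finset.mem_union,
        Finset.mem_filter] at this
      tauto
    have htI : t ∉ I := fun h => (Finset.mem_sdiff.1 (hI h)).2 htN
    refine ⟨insert t I, Finset.insert_subset ht (hI.trans Finset.sdiff_subset), ?_, ?_⟩
    · intro i hi j hj hij
      rcases Finset.mem_insert.1 hi with rfl | hiI <;>
        rcases Finset.mem_insert.1 hj with rfl | hjI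
      · exact absurd rfl hij
      · exact (hIN j hjI).2
      · exact (hIN i hiI).1
      · exact hind i hiI j hjI hij
    · have := Finset.card_le_card_sdiff_add_card (s := T) (t := N)
      rw [Finset.card_insert_of_notMem htI]
      linarith

theorem Biset.inner_card_add_outer_card_diff_lt {V : Type*} [DecidableEq V] {A B : Biset V}
    (h : ¬ StronglyDisjoint A B) :
    (A.diff B).inner.card + (A.diff B).outer.card < A.inner.card + A.outer.card := by
  have hi : (A.inner \ B.outer).card + (A.inner ∩ B.outer).card = A.inner.card :=
    Finset.card_sdiff_add_card_inter _ _
  have ho : (A.outer \ B.inner).card + (A.outer ∩ B.inner).card = A.outer.card :=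
    Finset.card_sdiff_add_card_inter _ _
  have hpos : 0 < (A.inner ∩ B.outer).card + (A.outer ∩ B.inner).card := by
    by_contra! h₀
    refine h ⟨Finset.card_eq_zero.1 (by omega), ?_⟩
    rw [Finset.inter_comm]
    exact Finset.card_eq_zero.1 (by omega)
  change (A.inner \ B.outer).card + (A.outer \ B.inner).card < _
  omega

theorem StronglyDisjoint.symm {V : Type*} [DecidableEq V] {A B : Biset V}
    (h : StronglyDisjoint A B) : StronglyDisjoint B A :=
  ⟨h.2, h.1⟩

/-- Members of a weakly posi-uncrossable family, each with an inner node avoided by the outer parts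
of all the others, can be uncrossed into pairwise strongly disjoint members. -/
theorem WeaklyPosiUncrossable.card_le_nuOf {V ι : Type*} [DecidableEq V]
    {F : Finset (Biset V)} (hF : WeaklyPosiUncrossable F) (I : Finset ι) (v : ι → V)
    (X : ι → Biset V) (hX : ∀ i ∈ I, X i ∈ F) (hv : ∀ i ∈ I, v i ∈ (X i).inner)
    (hout : ∀ i ∈ I, ∀ j ∈ I, i ≠ j → v i ∉ (X j).outer) :
    I.card ≤ nuOf F := by
  induction hn : ∑ i ∈ I, ((X i).inner.card + (X i).outer.card) using Nat.strong_induction_on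
    generalizing X with
  | _ n ih =>
    subst hn
    by_cases hd : ∀ i ∈ I, ∀ j ∈ I, i ≠ j → StronglyDisjoint (X i) (X j)
    · have hinj : Set.InjOn X I := fun i hi j hj hij => by
        by_contra hne
        exact hout i hi j hj hne (hij ▸ (X i).subset (hv i hi))
      rw [← Finset.card_image_of_injOn hinj]
      refine Finset.le_sup (f := Finset.card)
        (Finset.mem_filter.2 ⟨Finset.mem_powerset.2 (Finset.image_subset_iff.2 hX), ?_⟩)
      intro A hA B hB hAB
      obtain ⟨i, hi, rfl⟩ := Finset.mem_image.1 hA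
      obtain ⟨j, hj, rfl⟩ := Finset.mem_image.1 hB
      exact hd i hi j hj fun h => hAB (h ▸ rfl)
    · have step : ∀ i ∈ I, ∀ j ∈ I, i ≠ j → ¬ StronglyDisjoint (X i) (X j) →
          (X i).diff (X j) ∈ F → I.card ≤ nuOf F := by
        intro i hi j hj hij hnd hmem
        have hlt := Biset.inner_card_add_outer_card_diff_lt hnd
        refine ih _ ?_ (Function.update X i ((X i).diff (X j))) ?_ ?_ ?_ rfl
        · refine Finset.sum_lt_sum (fun k _ => ?_) ⟨i, hi, by simpa using hlt⟩
          rcases eq_or_ne k i with rfl | hk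
          · simpa using hlt.le
          · simp [hk]
        · intro k hk
          rcases eq_or_ne k i with rfl | hki
          · simpa using hmem
          · simpa [hki] using hX k hk
        · intro k hk
          rcases eq_or_ne k i with rfl | hki
          · simpa [Biset.diff] using And.intro (hv k hk) (hout k hk j hj hij)
          · simpa [hki] using hv k hk
        · intro k hk l hl hkl
          rcases eq_or_ne l i with rfl | hli
          · simpa [Biset.diff] using fun h => absurd h (hout k hk l hl hkl)
          · simpa [hli] using hout k hk l hl hkl
      push Not at hd
      obtain ⟨i, hi, j, hj, hij, hnd⟩ := hd
      rcases hF (X i) (hX i hi) (X j) (hX j hj)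
        ⟨v i, Finset.mem_sdiff.2 ⟨hv i hi, hout i hi j hj hij⟩⟩
        ⟨v j, Finset.mem_sdiff.2 ⟨hv j hj, hout j hj i hi hij.symm⟩⟩ with h | h
      · exact step i hi j hj hij hnd h
      · exact step j hj i hi hij.symm (fun h' => hnd h'.symm) h

/-- A finite family of finite sets has a subfamily with the same union in which every member has
an element belonging to no other member. -/
theorem Finset.exists_subset_sup_eq_forall_exists_private {ι V : Type*} [DecidableEq V]
    (F : Finset ι) (f : ι → Finset V) :
    ∃ C ⊆ F, C.sup f = F.sup f ∧
      ∀ A ∈ C, ∃ x ∈ f A, ∀ B ∈ C, A ≠ B → x ∉ f B := by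
  obtain ⟨C, hC, hmin⟩ := Finset.exists_min_image
    (F.powerset.filter fun C => C.sup f = F.sup f) Finset.card ⟨F, by simp⟩
  simp only [Finset.mem_filter, Finset.mem_powerset] at hC hmin
  refine ⟨C, hC.1, hC.2, fun A hA => ?_⟩
  by_contra! hcon
  refine (Finset.card_erase_lt_of_mem hA).not_ge
    (hmin _ ⟨(Finset.erase_subset _ _).trans hC.1, le_antisymm ?_ ?_⟩)
  · exact Finset.sup_mono ((Finset.erase_subset _ _).trans hC.1)
  · rw [← hC.2]
    intro x hx
    obtain ⟨B, hB, hxB⟩ := Finset.mem_sup.1 hx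
    rcases eq_or_ne A B with rfl | hAB
    · obtain ⟨D, hD, hAD, hxD⟩ := hcon x hxB
      exact Finset.mem_sup.2 ⟨D, Finset.mem_erase.2 ⟨hAD.symm, hD⟩, hxD⟩
    · exact Finset.mem_sup.2 ⟨B, Finset.mem_erase.2 ⟨hAB.symm, hB⟩, hxB⟩

theorem stmt_16 {V : Type*} [Fintype V] [DecidableEq V]
    (F : Finset (Biset V)) (hF : WeaklyPosiUncrossable F) :
    (F.sup Biset.inner).card ≤
      (F.sup fun A => A.inner.card) *
        (2 * (F.sup fun A => (Biset.boundary A).card) + 1) * nuOf F := by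
  rcases isEmpty_or_nonempty V with _ | _
  · simp [Finset.eq_empty_of_isEmpty]
  obtain ⟨C, hCF, hsup, hpriv⟩ := F.exists_subset_sup_eq_forall_exists_private Biset.inner
  choose! v hv hv' using hpriv
  have hinj : Set.InjOn v C := fun A hA B hB h => by
    by_contra hne
    exact hv' A hA B hB hne (h ▸ hv B hB)
  set g := F.sup fun A => (Biset.boundary A).card
  obtain ⟨I, hIC, hind, hcard⟩ :=
    exists_independent_of_inDegree_le (fun A B => v A ∈ B.boundary) g C fun B hB => by
      refine (Finset.card_le_card_of_injOn v (t := B.boundary) (fun A hA => ?_)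
        (hinj.mono fun A hA => ?_)).trans
        (Finset.le_sup (f := fun A => (Biset.boundary A).card) (hCF hB))
      · simp_all
      · simp_all
  have hI : I.card ≤ nuOf F := hF.card_le_nuOf I v id (fun A hA => hCF (hIC hA))
    (fun A hA => hv A (hIC hA)) fun A hA B hB hAB hmem =>
      hind A hA B hB hAB (Finset.mem_sdiff.2 ⟨hmem, hv' A (hIC hA) B (hIC hB) hAB⟩)
  set p := F.sup fun A => A.inner.card
  calc (F.sup Biset.inner).card = (C.biUnion Biset.inner).card := by
        rw [← hsup, Finset.sup_eq_biUnion]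
    _ ≤ C.card * p := Finset.card_biUnion_le_card_mul _ _ _ fun A hA =>
        Finset.le_sup (f := fun A : Biset V => A.inner.card) (hCF hA)
    _ ≤ (2 * g + 1) * nuOf F * p :=
        Nat.mul_le_mul_right p (hcard.trans (Nat.mul_le_mul_left _ hI))
    _ = p * (2 * g + 1) * nuOf F := by ring
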